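/- arXiv:1002.3422 — 5 statements merged into one kernel-verified Lean document; each statement's English description precedes it below -/
import Mathlib

section
/- Let B = ∏_{j=1}^n [u_j, v_j] ⊂ ℝ^n be a box with sides parallel to the axes, let 𝔞 be a nonzero ideal of O_L and let t₀ ∈ O_L. Then the number of t ∈ O_L with t ≡ t₀ (mod 𝔞) and (ι_1(t), …, ι_n(t)) ∈ B is at most vol(B)/N(𝔞) + 1, where vol(B) = ∏_{j=1}^n (v_j − u_j). -/
open NumberField

/-- If `L` has as many real embeddings as its degree, the norm is the product of them. -/
theorem norm_eq_prod_real_embeddings {L : Type*} [Field L] [NumberField L] {n : ℕ}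
    (hn : n = Module.finrank ℚ L) (ι : Fin n → (L →+* ℝ)) (hι : Function.Injective ι) (x : L) :
    ((Algebra.norm ℚ x : ℚ) : ℝ) = ∏ j, ι j x := by
  let φ : Fin n → (L →ₐ[ℚ] ℂ) := fun j => (Complex.ofRealHom.comp (ι j)).toRatAlgHom
  have hφ : Function.Bijective φ := by
    rw [Fintype.bijective_iff_injective_and_card]
    refine ⟨fun i j hij => hι (RingHom.ext fun y => ?_), ?_⟩
    · exact Complex.ofReal_injective (DFunLike.congr_fun hij y)
    · rw [Fintype.card_fin, AlgHom.card, hn]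
  have h := Algebra.norm_eq_prod_embeddings ℚ ℂ x
  rw [← hφ.prod_comp fun σ : L →ₐ[ℚ] ℂ => σ x] at h
  apply Complex.ofReal_injective
  rw [Complex.ofReal_prod, Complex.ofReal_ratCast]
  exact h

/-- A nonzero element of `𝔞` has norm at least `N(𝔞)` in absolute value. -/
theorem absNorm_le_prod_abs_real_embeddings {L : Type*} [Field L] [NumberField L] {n : ℕ}
    (hn : n = Module.finrank ℚ L) (ι : Fin n → (L →+* ℝ)) (hι : Function.Injective ι)
    {𝔞 : Ideal (𝓞 L)} {x : 𝓞 L} (hx : x ∈ 𝔞) (hx0 : x ≠ 0) :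
    (Ideal.absNorm 𝔞 : ℝ) ≤ ∏ j, |ι j (x : L)| := by
  rw [← Finset.abs_prod, ← norm_eq_prod_real_embeddings hn ι hι, ← Algebra.coe_norm_int]
  have h : (Ideal.absNorm 𝔞 : ℤ) ≤ |Algebra.norm ℤ x| :=
    Int.le_of_dvd (abs_pos.2 (Algebra.norm_ne_zero_iff.2 hx0))
      ((dvd_abs _ _).2 (Ideal.absNorm_dvd_norm_of_mem hx))
  exact_mod_cast h

/-- A set on which a nonnegative real function is `1`-separated and bounded by `M` has at most
`M + 1` elements. -/
theorem Set.finite_and_ncard_le_of_one_le_abs_sub {α : Type*} {S : Set α} {g : α → ℝ} {M : ℝ}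
    (hM : 0 ≤ M) (hg : ∀ t ∈ S, 0 ≤ g t ∧ g t ≤ M)
    (hsep : ∀ s ∈ S, ∀ t ∈ S, s ≠ t → 1 ≤ |g s - g t|) :
    S.Finite ∧ (S.ncard : ℝ) ≤ M + 1 := by
  have hinj : Set.InjOn (fun t => ⌊g t⌋₊) S := by
    intro s hs t ht hst
    by_contra hne
    refine (hsep s hs t ht hne).not_gt (Int.abs_sub_lt_one_of_floor_eq_floor ?_)
    rw [← Int.natCast_floor_eq_floor (hg s hs).1, ← Int.natCast_floor_eq_floor (hg t ht).1]
    exact_mod_cast hst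
  have hmaps : ∀ t ∈ S, ⌊g t⌋₊ ∈ (Finset.range (⌊M⌋₊ + 1) : Set ℕ) := by
    intro t ht
    rw [Finset.mem_coe, Finset.mem_range]
    exact Nat.lt_succ_of_le (Nat.floor_mono (hg t ht).2)
  refine ⟨Set.Finite.of_injOn hmaps hinj (Finset.finite_toSet _), ?_⟩
  have h := Set.ncard_le_ncard_of_injOn _ hmaps hinj (Finset.finite_toSet _)
  rw [Set.ncard_coe_finset, Finset.card_range] at h
  calc (S.ncard : ℝ) ≤ ⌊M⌋₊ + 1 := by exact_mod_cast h
    _ ≤ M + 1 := by gcongr; exact Nat.floor_le hM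

/-- Let `L` be a totally real number field of degree `n` with real
embeddings `ι 1, …, ι n`, let `B = ∏ [u j, v j]` be a box in `ℝ^n` with sides parallel to
the axes, let `𝔞` be a nonzero ideal of `𝓞 L` and `t₀ ∈ 𝓞 L`.  Then the number of
`t ∈ 𝓞 L` with `t ≡ t₀ (mod 𝔞)` and `(ι 1 t, …, ι n t) ∈ B` is at most
`vol(B)/N(𝔞) + 1`. -/
theorem stmt_0 {L : Type*} [Field L] [NumberField L] {n : ℕ}
    (hn : n = Module.finrank ℚ L)
    (ι : Fin n → (L →+* ℝ)) (hι : Function.Injective ι)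
    (𝔞 : Ideal (𝓞 L)) (h𝔞 : 𝔞 ≠ ⊥) (t₀ : 𝓞 L)
    (u v : Fin n → ℝ) (huv : ∀ j, u j ≤ v j) :
    {t : 𝓞 L | t - t₀ ∈ 𝔞 ∧ ∀ j, ι j (t : L) ∈ Set.Icc (u j) (v j)}.Finite ∧
    (({t : 𝓞 L | t - t₀ ∈ 𝔞 ∧ ∀ j, ι j (t : L) ∈ Set.Icc (u j) (v j)}.ncard : ℝ) ≤
      (∏ j, (v j - u j)) / (Ideal.absNorm 𝔞 : ℝ) + 1) := by
  obtain ⟨m, rfl⟩ : ∃ m, n = m + 1 :=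
    Nat.exists_eq_succ_of_ne_zero (hn ▸ Module.finrank_pos.ne')
  have hN : (0 : ℝ) < Ideal.absNorm 𝔞 := by
    exact_mod_cast Nat.pos_of_ne_zero (mt Ideal.absNorm_eq_zero_iff.1 h𝔞)
  set C : ℝ := ∏ j : Fin m, (v j.succ - u j.succ) with hC
  have hC0 : 0 ≤ C := Finset.prod_nonneg fun j _ => sub_nonneg.2 (huv _)
  rw [Fin.prod_univ_succ, ← hC]
  refine Set.finite_and_ncard_le_of_one_le_abs_sub
    (g := fun t : 𝓞 L => (ι 0 (t : L) - u 0) * C / Ideal.absNorm 𝔞)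
    (div_nonneg (mul_nonneg (sub_nonneg.2 (huv 0)) hC0) hN.le) ?_ ?_
  · rintro t ⟨-, ht⟩
    have h0 := sub_nonneg.2 (ht 0).1
    have h1 := (ht 0).2
    exact ⟨by positivity, by gcongr⟩
  · rintro s ⟨hs, hs'⟩ t ⟨ht, ht'⟩ hst
    have hmem : s - t ∈ 𝔞 := by simpa using 𝔞.sub_mem hs ht
    have h := absNorm_le_prod_abs_real_embeddings hn ι hι hmem (sub_ne_zero.2 hst)
    rw [Fin.prod_univ_succ] at h
    have hsub : ∀ j, ι j ((s - t : 𝓞 L) : L) = ι j (s : L) - ι j (t : L) :=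
      fun j => map_sub (ι j) (s : L) (t : L)
    have hle : ∏ j : Fin m, |ι j.succ ((s - t : 𝓞 L) : L)| ≤ C := by
      refine Finset.prod_le_prod (fun _ _ => abs_nonneg _) fun j _ => ?_
      rw [hsub]
      exact abs_sub_le_of_le_of_le (hs' _).1 (hs' _).2 (ht' _).1 (ht' _).2
    have hdiff : (ι 0 (s : L) - u 0) * C / Ideal.absNorm 𝔞 -
        (ι 0 (t : L) - u 0) * C / Ideal.absNorm 𝔞 =
        ι 0 ((s - t : 𝓞 L) : L) * C / Ideal.absNorm 𝔞 := by
      rw [hsub]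
      ring
    rw [hdiff, abs_div, abs_mul, abs_of_nonneg hC0, abs_of_pos hN, one_le_div hN]
    exact h.trans (mul_le_mul_of_nonneg_left hle (abs_nonneg _))
end

section
/- For every ε > 0 there exists a constant C > 0 such that for every nonzero t ∈ O_L, the set {(a, b) ∈ O_L × O_L : a² + b² = t} is finite and has cardinality at most C · |N_{L/ℚ}(t)|^ε. -/
open NumberField

/-- A uniform exponential bound for linear growth. -/
theorem exists_natCast_add_one_le_mul_rpow {ε : ℝ} (hε : 0 < ε) :
    ∃ c : ℝ, 1 ≤ c ∧ ∀ q k : ℕ, 2 ≤ q → (k + 1 : ℝ) ≤ c * ((q : ℝ) ^ k) ^ ε := by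
  have hlog : 0 < Real.log 2 := Real.log_pos one_lt_two
  refine ⟨1 + 1 / (ε * Real.log 2), by linarith [show 0 < 1 / (ε * Real.log 2) by positivity],
    fun q k hq ↦ ?_⟩
  have hq' : (2 : ℝ) ≤ q := by exact_mod_cast hq
  have hexp : k * (ε * Real.log 2) + 1 ≤ ((q : ℝ) ^ k) ^ ε := by
    calc k * (ε * Real.log 2) + 1 ≤ Real.exp (k * (ε * Real.log 2)) := Real.add_one_le_exp _
      _ = ((2 : ℝ) ^ k) ^ ε := by
        rw [Real.rpow_def_of_pos (by positivity), Real.log_pow]; ring_nf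
      _ ≤ ((q : ℝ) ^ k) ^ ε := by gcongr
  calc (k + 1 : ℝ) ≤ (1 + 1 / (ε * Real.log 2)) * (k * (ε * Real.log 2) + 1) := by
        have h1 : 1 / (ε * Real.log 2) * (k * (ε * Real.log 2)) = k := by field_simp
        have h2 : 0 ≤ k * (ε * Real.log 2) := by positivity
        have h3 : 0 ≤ 1 / (ε * Real.log 2) := by positivity
        nlinarith
    _ ≤ _ := by gcongr

theorem natCast_add_one_le_pow_rpow {ε : ℝ} {q : ℕ} (k : ℕ) (hq : 2 ≤ (q : ℝ) ^ ε) :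
    (k + 1 : ℝ) ≤ ((q : ℝ) ^ k) ^ ε := by
  have h : (k + 1 : ℝ) ≤ 2 ^ k := by exact_mod_cast Nat.lt_two_pow_self (n := k)
  rw [← Real.rpow_natCast_mul (by positivity), mul_comm, Real.rpow_mul_natCast (by positivity)]
  exact h.trans (by gcongr)

section Dedekind

variable {R : Type*} [CommRing R] [IsDedekindDomain R]

open UniqueFactorizationMonoid

/-- The divisors of a nonzero ideal are finite in number, and are counted by the exponents in its
prime factorization. -/
theorem Ideal.finite_divisors_and_ncard_le [DecidableEq (Ideal R)] {I : Ideal R} (hI : I ≠ 0) :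
    {J | J ∣ I}.Finite ∧ {J | J ∣ I}.ncard ≤
      ∏ P ∈ (normalizedFactors I).toFinset, ((normalizedFactors I).count P + 1) := by
  have hsub : {J | J ∣ I} ⊆ Multiset.prod '' (Finset.Iic (normalizedFactors I) : Set _) := by
    intro J hJ
    have hJ0 : J ≠ 0 := ne_zero_of_dvd_ne_zero hI hJ
    refine ⟨normalizedFactors J, ?_, prod_normalizedFactors_eq_self hJ0⟩
    simpa using (dvd_iff_normalizedFactors_le_normalizedFactors hJ0 hI).1 hJ
  have hfin := (Finset.finite_toSet (Finset.Iic (normalizedFactors I))).image Multiset.prod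
  refine ⟨hfin.subset hsub, (Set.ncard_le_ncard hsub hfin).trans ?_⟩
  refine (Set.ncard_image_le (Finset.finite_toSet _)).trans ?_
  rw [Set.ncard_coe_finset, Multiset.card_Iic]

/-- The divisor bound for ideals: `I` has at most `C * N(I) ^ ε` divisors. -/
theorem Ideal.exists_ncard_divisors_le [CharZero R] [Module.Free ℤ R] [Module.Finite ℤ R]
    {ε : ℝ} (hε : 0 < ε) :
    ∃ C > (0 : ℝ), ∀ I : Ideal R, I ≠ 0 →
      ({J | J ∣ I}.ncard : ℝ) ≤ C * (Ideal.absNorm I : ℝ) ^ ε := by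
  classical
  obtain ⟨c, hc1, hc⟩ := exists_natCast_add_one_le_mul_rpow hε
  obtain ⟨B, hB⟩ := exists_nat_ge ((2 : ℝ) ^ ε⁻¹)
  have hS : {P : Ideal R | Ideal.absNorm P ≤ B}.Finite := Ideal.finite_setOfPred_absNorm_le B
  refine ⟨c ^ hS.toFinset.card, by positivity, fun I hI ↦ ?_⟩
  set F := normalizedFactors I
  have hnorm : (Ideal.absNorm I : ℝ) = ∏ P ∈ F.toFinset, (Ideal.absNorm P : ℝ) ^ F.count P := by
    conv_lhs => rw [← prod_normalizedFactors_eq_self hI]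
    rw [map_multiset_prod, Finset.prod_multiset_map_count]
    push_cast; rfl
  have htwo : ∀ P ∈ F.toFinset, 2 ≤ Ideal.absNorm P := by
    intro P hP
    have hP := prime_of_normalized_factor P (Multiset.mem_toFinset.1 hP)
    have h0 : Ideal.absNorm P ≠ 0 := mt Ideal.absNorm_eq_zero_iff.1 hP.ne_zero
    have h1 : Ideal.absNorm P ≠ 1 := fun h ↦ hP.not_isUnit <|
      Ideal.isUnit_iff.2 (Ideal.absNorm_eq_one_iff.1 h)
    omega
  calc ({J | J ∣ I}.ncard : ℝ) ≤ ∏ P ∈ F.toFinset, (F.count P + 1 : ℝ) := by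
        exact_mod_cast (Ideal.finite_divisors_and_ncard_le hI).2
    _ ≤ ∏ P ∈ F.toFinset, (if P ∈ hS.toFinset then c else 1) *
          ((Ideal.absNorm P : ℝ) ^ F.count P) ^ ε := by
        refine Finset.prod_le_prod (fun _ _ ↦ by positivity) fun P hP ↦ ?_
        split_ifs with h
        · exact hc _ _ (htwo P hP)
        · rw [one_mul]
          refine natCast_add_one_le_pow_rpow _ ?_
          have hlt : (B : ℝ) ≤ Ideal.absNorm P := by
            exact_mod_cast (not_le.1 fun h' ↦ h (by simpa using h')).le
          calc (2 : ℝ) = ((2 : ℝ) ^ ε⁻¹) ^ ε := (Real.rpow_inv_rpow zero_le_two hε.ne').symm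
            _ ≤ _ := by gcongr; exact hB.trans hlt
    _ = (∏ P ∈ F.toFinset, if P ∈ hS.toFinset then c else 1) * (Ideal.absNorm I : ℝ) ^ ε := by
        rw [Finset.prod_mul_distrib, hnorm, Real.finsetProd_rpow _ _ (fun _ _ ↦ by positivity)]
    _ ≤ _ := by
        gcongr
        rw [Finset.prod_ite, Finset.prod_const, Finset.prod_const_one, mul_one]
        refine pow_le_pow_right₀ hc1 (Finset.card_le_card fun P hP ↦ (Finset.mem_filter.1 hP).2)

end Dedekind

/-- Divisors of an ideal with prescribed absolute values at the infinite places are determined by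
the ideals they generate, up to roots of unity. -/
theorem NumberField.finite_and_ncard_le_of_infinitePlace_eq {M : Type*} [Field M] [NumberField M]
    {I : Ideal (𝓞 M)} (hI : I ≠ 0) {Z : Set (𝓞 M)} (hdvd : ∀ z ∈ Z, Ideal.span {z} ∣ I)
    (hplace : ∀ z ∈ Z, ∀ z' ∈ Z, ∀ w : InfinitePlace M, w z = w z') :
    Z.Finite ∧ Z.ncard ≤ {J | J ∣ I}.ncard * Units.torsionOrder M := by
  classical
  let r : Ideal (𝓞 M) → 𝓞 M := fun J ↦
    if h : ∃ z ∈ Z, Ideal.span {z} = J then h.choose else 0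
  have hsub : Z ⊆ (fun p : Ideal (𝓞 M) × Units.torsion M ↦ r p.1 * ((p.2 : (𝓞 M)ˣ) : 𝓞 M)) ''
      ({J | J ∣ I} ×ˢ Set.univ) := by
    intro z hz
    have hex : ∃ z' ∈ Z, Ideal.span {z'} = Ideal.span {z} := ⟨z, hz, rfl⟩
    have hr : r (Ideal.span {z}) = hex.choose := dif_pos hex
    obtain ⟨hrZ, hspan⟩ := hex.choose_spec
    rw [← hr] at hrZ hspan
    obtain ⟨u, hu⟩ := Ideal.span_singleton_eq_span_singleton.1 hspan
    have hz0 : z ≠ 0 := by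
      rintro rfl
      exact ne_zero_of_dvd_ne_zero hI (hdvd _ hz) (by simp)
    have htors : u ∈ Units.torsion M := (Units.mem_torsion M).2 fun w ↦ by
      have h : w (r (Ideal.span {z})) * w (u : 𝓞 M) = w z := by
        rw [← map_mul, ← map_mul, hu]
      have hne : w (r (Ideal.span {z}) : M) ≠ 0 := by
        rw [hplace _ hrZ _ hz w]
        simpa using hz0
      exact mul_left_cancel₀ hne <| by
        rw [mul_one]; exact h.trans (hplace _ hrZ _ hz w).symm
    exact ⟨(Ideal.span {z}, ⟨u, htors⟩), ⟨hdvd _ hz, trivial⟩, hu⟩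
  have hfin : ({J | J ∣ I} ×ˢ (Set.univ : Set (Units.torsion M))).Finite :=
    (Ideal.finite_divisors_and_ncard_le hI).1.prod Set.finite_univ
  refine ⟨(hfin.image _).subset hsub, (Set.ncard_le_ncard hsub (hfin.image _)).trans ?_⟩
  refine (Set.ncard_image_le hfin).trans ?_
  rw [Set.ncard_prod, Set.ncard_univ, Units.torsionOrder]

theorem Complex.sq_norm_add_mul_of_sq_eq_neg_one {α β j : ℂ} (hα : α.im = 0) (hβ : β.im = 0)
    (hj : j ^ 2 = -1) : ‖α + β * j‖ ^ 2 = (α ^ 2 + β ^ 2).re := by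
  rw [← Complex.I_sq, sq_eq_sq_iff_eq_or_eq_neg] at hj
  rw [Complex.sq_norm]
  rcases hj with rfl | rfl <;> simp [Complex.normSq_apply, hα, hβ, sq]

/-- In characteristic zero, `a + b * i` determines `a` and `b` once the nonzero value of
`a ^ 2 + b ^ 2` is known. -/
theorem eq_and_eq_of_add_mul_eq {R : Type*} [CommRing R] [IsDomain R] [CharZero R]
    {i a b a' b' t : R} (hi : i ^ 2 = -1) (ht : t ≠ 0) (h : a ^ 2 + b ^ 2 = t)
    (h' : a' ^ 2 + b' ^ 2 = t) (heq : a + b * i = a' + b' * i) : a = a' ∧ b = b' := by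
  have hi0 : i ≠ 0 := by rintro rfl; simp at hi
  have hne : a + b * i ≠ 0 := fun h0 ↦ ht <| by
    linear_combination -h + (a - b * i) * h0 + b ^ 2 * hi
  have hconj : a - b * i = a' - b' * i := mul_left_cancel₀ hne <| by
    linear_combination h - h' - (b ^ 2 - b' ^ 2) * hi - (a' - b' * i) * heq
  have htwo : (2 : R) ≠ 0 := two_ne_zero
  exact ⟨mul_left_cancel₀ htwo (by linear_combination heq + hconj),
    mul_right_cancel₀ hi0 (mul_left_cancel₀ htwo (by linear_combination heq - hconj))⟩

/-- Let `L` be a totally real number field with ring of integers `𝓞 L`.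
For every `ε > 0` there is a constant `C > 0` such that for every nonzero `t ∈ 𝓞 L` the
set `{(a, b) : a² + b² = t}` is finite of cardinality at most `C · |N_{L/ℚ}(t)|^ε`. -/
theorem stmt_1 {L : Type*} [Field L] [NumberField L]
    (htotallyreal : ∀ φ : L →+* ℂ, ∀ x : L, (φ x).im = 0)
    {ε : ℝ} (hε : 0 < ε) :
    ∃ C > (0 : ℝ), ∀ t : 𝓞 L, t ≠ 0 →
      {p : 𝓞 L × 𝓞 L | p.1 ^ 2 + p.2 ^ 2 = t}.Finite ∧
      (({p : 𝓞 L × 𝓞 L | p.1 ^ 2 + p.2 ^ 2 = t}.ncard : ℝ) ≤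
        C * (|Algebra.norm ℤ t| : ℝ) ^ ε) := by
  let M := CyclotomicField 4 L
  obtain ⟨i, hi⟩ : ∃ i : 𝓞 M, i ^ 2 = -1 := by
    have hζ := (IsCyclotomicExtension.zeta_spec 4 L M).toInteger_isPrimitiveRoot
    exact ⟨_, (hζ.pow (by norm_num) (by norm_num : 4 = 2 * 2)).eq_neg_one_of_two_right⟩
  have hinj : Function.Injective (algebraMap (𝓞 L) (𝓞 M)) := FaithfulSMul.algebraMap_injective _ _
  have hn : 0 < Module.finrank (𝓞 L) (𝓞 M) := Module.finrank_pos
  obtain ⟨C, hC, hbound⟩ := Ideal.exists_ncard_divisors_le (R := 𝓞 M)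
    (ε := ε / Module.finrank (𝓞 L) (𝓞 M)) (by positivity)
  refine ⟨C * Units.torsionOrder M, mul_pos hC (by exact_mod_cast Units.torsionOrder_pos M),
    fun t ht ↦ ?_⟩
  set S := {p : 𝓞 L × 𝓞 L | p.1 ^ 2 + p.2 ^ 2 = t}
  let f : 𝓞 L × 𝓞 L → 𝓞 M := fun p ↦ algebraMap _ _ p.1 + algebraMap _ _ p.2 * i
  have ht' : algebraMap (𝓞 L) (𝓞 M) t ≠ 0 := by simpa using hinj.ne ht
  have hS {p : 𝓞 L × 𝓞 L} (hp : p ∈ S) :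
      algebraMap (𝓞 L) (𝓞 M) p.1 ^ 2 + algebraMap (𝓞 L) (𝓞 M) p.2 ^ 2 = algebraMap _ _ t := by
    rw [← map_pow, ← map_pow, ← map_add]; exact congrArg _ hp
  have hf : Set.InjOn f S := fun p hp q hq hpq ↦
    have h := eq_and_eq_of_add_mul_eq hi ht' (hS hp) (hS hq) hpq
    Prod.ext (hinj h.1) (hinj h.2)
  let I : Ideal (𝓞 M) := (Ideal.span {t}).map (algebraMap (𝓞 L) (𝓞 M))
  have hIspan : I = Ideal.span {algebraMap (𝓞 L) (𝓞 M) t} := by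
    simp only [I, Ideal.map_span, Set.image_singleton]
  have hI : I ≠ 0 := by rw [hIspan]; simpa using ht
  have hdvd : ∀ z ∈ f '' S, Ideal.span {z} ∣ I := by
    rintro _ ⟨p, hp, rfl⟩
    rw [hIspan, Ideal.dvd_span_singleton, Ideal.mem_span_singleton, ← hS hp]
    exact ⟨algebraMap _ _ p.1 - algebraMap _ _ p.2 * i, by
      linear_combination algebraMap (𝓞 L) (𝓞 M) p.2 ^ 2 * hi⟩
  have hsq : ∀ z ∈ f '' S, ∀ w : InfinitePlace M,
      w z ^ 2 = (w.embedding (algebraMap (𝓞 L) (𝓞 M) t : 𝓞 M)).re := by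
    rintro _ ⟨p, hp, rfl⟩ w
    have hreal (x : 𝓞 L) : (w.embedding (algebraMap (𝓞 L) (𝓞 M) x : 𝓞 M)).im = 0 :=
      htotallyreal (w.embedding.comp (algebraMap L M)) x
    have hj : w.embedding (i : M) ^ 2 = -1 := by
      rw [← map_pow, ← map_pow, hi]; simp
    rw [← hS hp, ← InfinitePlace.norm_embedding_eq]
    simp only [f, map_add, map_mul, map_pow]
    exact Complex.sq_norm_add_mul_of_sq_eq_neg_one (hreal _) (hreal _) hj
  obtain ⟨hfin, hcard⟩ := finite_and_ncard_le_of_infinitePlace_eq hI hdvd fun z hz z' hz' w ↦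
    (sq_eq_sq₀ (apply_nonneg _ _) (apply_nonneg _ _)).1 ((hsq z hz w).trans (hsq z' hz' w).symm)
  refine ⟨hfin.of_finite_image hf, ?_⟩
  have hnorm : (Ideal.absNorm I : ℝ) =
      (|Algebra.norm ℤ t| : ℝ) ^ Module.finrank (𝓞 L) (𝓞 M) := by
    rw [Ideal.absNorm_algebraMap, Ideal.absNorm_span_singleton, Nat.cast_pow, Nat.cast_natAbs,
      Int.cast_abs]
  rw [← hf.ncard_image]
  calc ((f '' S).ncard : ℝ) ≤ {J | J ∣ I}.ncard * Units.torsionOrder M := by exact_mod_cast hcard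
    _ ≤ C * (Ideal.absNorm I : ℝ) ^ (ε / Module.finrank (𝓞 L) (𝓞 M)) * Units.torsionOrder M := by
        gcongr; exact hbound I hI
    _ = _ := by
        rw [hnorm, ← Real.rpow_natCast_mul (abs_nonneg _), mul_div_cancel₀ _ (by positivity)]
        ring
end

section
/- Suppose a, b, c, d, p, q ∈ O_L satisfy a² − p·b² − q·c² + p·q·d² = 1, with b, c, d ∈ 𝔞 and a − 1 ∈ 𝔞. Then a − 1 ∈ 𝔞². (Equivalently, every norm-one element α = a + bI + cJ + dK of the order R of the quaternion algebra (p,q/L) that is congruent to 1 modulo 𝔞 has trace Tr(α) = 2a ≡ 2 (mod 𝔞²).) -/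
open NumberField

/-- Let `L` be a number field and `𝔞` a nonzero ideal of `𝓞 L` coprime
to the principal ideal `(2)`.  If `a, b, c, d, p, q ∈ 𝓞 L` satisfy
`a² − p·b² − q·c² + p·q·d² = 1` with `b, c, d ∈ 𝔞` and `a − 1 ∈ 𝔞`, then `a − 1 ∈ 𝔞²`. -/
theorem stmt_4 {L : Type*} [Field L] [NumberField L]
    (𝔞 : Ideal (𝓞 L)) (h𝔞 : 𝔞 ≠ ⊥)
    (hcop : IsCoprime 𝔞 (Ideal.span {(2 : 𝓞 L)}))
    (a b c d p q : 𝓞 L)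
    (hnorm : a ^ 2 - p * b ^ 2 - q * c ^ 2 + p * q * d ^ 2 = 1)
    (hb : b ∈ 𝔞) (hc : c ∈ 𝔞) (hd : d ∈ 𝔞) (ha : a - 1 ∈ 𝔞) :
    a - 1 ∈ 𝔞 ^ 2 := by
  have sq_mem {x : 𝓞 L} (hx : x ∈ 𝔞) : x ^ 2 ∈ 𝔞 ^ 2 := Ideal.pow_mem_pow hx 2
  have two_mul_mem : 2 * (a - 1) ∈ 𝔞 ^ 2 := by
    have key : 2 * (a - 1) = p * b ^ 2 + q * c ^ 2 - p * q * d ^ 2 - (a - 1) ^ 2 := by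
      linear_combination hnorm
    rw [key]
    exact sub_mem (sub_mem (add_mem (Ideal.mul_mem_left _ _ (sq_mem hb))
      (Ideal.mul_mem_left _ _ (sq_mem hc))) (Ideal.mul_mem_left _ _ (sq_mem hd))) (sq_mem ha)
  obtain ⟨x, hx, y, hy, hxy⟩ := Ideal.isCoprime_iff_exists.mp hcop
  obtain ⟨z, rfl⟩ := Ideal.mem_span_singleton.mp hy
  have decomp : a - 1 = x * (a - 1) + z * (2 * (a - 1)) := by
    linear_combination -(a - 1) * hxy
  rw [decomp]
  refine add_mem ?_ (Ideal.mul_mem_left _ _ two_mul_mem)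
  rw [pow_two]
  exact Ideal.mul_mem_mul hx ha
end

section
/- For all real numbers t, t', θ, the sum of the squares of the four entries of the matrix a_{−t} · k_θ · a_{t'} equals 2·( sin²(θ/2)·cosh(t + t') + cos²(θ/2)·cosh(t − t') ); equivalently, cosh(H(a_{−t} k_θ a_{t'})) = sin²(θ/2)·cosh(t + t') + cos²(θ/2)·cosh(t − t'). -/
open Matrix MatrixGroups

/-- The displacement `H(g) = dist(g·i, i)` of the point `i` of the upper half-plane under
`g ∈ SL(2,ℝ)`, where `dist` is the hyperbolic distance. -/
noncomputable def Hdisp (g : SL(2, ℝ)) : ℝ :=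
  dist (g • UpperHalfPlane.I) UpperHalfPlane.I

/-- The diagonal element `a_t = (e^{t/2}, 0; 0, e^{−t/2}) ∈ SL(2,ℝ)`. -/
noncomputable def aElt (t : ℝ) : SL(2, ℝ) :=
  ⟨!![Real.exp (t / 2), 0; 0, Real.exp (-(t / 2))], by
    rw [Matrix.det_fin_two_of, ← Real.exp_add]
    norm_num⟩

/-- The rotation `k_θ = (cos(θ/2), sin(θ/2); −sin(θ/2), cos(θ/2)) ∈ SO(2) ⊂ SL(2,ℝ)`. -/
noncomputable def kElt (θ : ℝ) : SL(2, ℝ) :=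
  ⟨!![Real.cos (θ / 2), Real.sin (θ / 2); -Real.sin (θ / 2), Real.cos (θ / 2)], by
    rw [Matrix.det_fin_two_of]
    linear_combination Real.sin_sq_add_cos_sq (θ / 2)⟩

/-- The displacement of `i` under `g ∈ SL(2,ℝ)` is determined by the Hilbert–Schmidt norm of `g`. -/
theorem two_mul_cosh_Hdisp (g : SL(2, ℝ)) :
    2 * Real.cosh (Hdisp g) = g 0 0 ^ 2 + g 0 1 ^ 2 + g 1 0 ^ 2 + g 1 1 ^ 2 := by
  have hdet : g 0 0 * g 1 1 - g 0 1 * g 1 0 = 1 := by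
    rw [← Matrix.det_fin_two, g.det_coe]
  have hpos : g 1 0 ^ 2 + g 1 1 ^ 2 ≠ 0 := by
    intro h
    have hc : g 1 0 = 0 := by nlinarith [sq_nonneg (g 1 0), sq_nonneg (g 1 1)]
    have hd : g 1 1 = 0 := by nlinarith [sq_nonneg (g 1 0), sq_nonneg (g 1 1)]
    simp [hc, hd] at hdet
  have hcoe : ((g • UpperHalfPlane.I : UpperHalfPlane) : ℂ) =
      (g 0 0 * Complex.I + g 0 1) / (g 1 0 * Complex.I + g 1 1) := by
    rw [UpperHalfPlane.coe_specialLinearGroup_apply]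
    simp
  have hnormSq : Complex.normSq (g 1 0 * Complex.I + g 1 1) = g 1 0 ^ 2 + g 1 1 ^ 2 := by
    simp [Complex.normSq_apply]
    ring
  have hre : (g • UpperHalfPlane.I).re =
      (g 0 0 * g 1 0 + g 0 1 * g 1 1) / (g 1 0 ^ 2 + g 1 1 ^ 2) := by
    rw [← UpperHalfPlane.coe_re, hcoe, Complex.div_re, hnormSq, ← add_div]
    simp [add_comm]
  have him : (g • UpperHalfPlane.I).im = 1 / (g 1 0 ^ 2 + g 1 1 ^ 2) := by
    rw [← UpperHalfPlane.coe_im, hcoe, Complex.div_im, hnormSq, ← sub_div]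
    congr 1
    simpa using hdet
  rw [Hdisp, UpperHalfPlane.cosh_dist', hre, him, UpperHalfPlane.I_re, UpperHalfPlane.I_im]
  field_simp
  linear_combination (-(g 0 0 * g 1 1 - g 0 1 * g 1 0) - 1) * hdet

/-- The sum of the squares of the entries of `a_{-t} k_θ a_{t'}`. -/
theorem sum_sq_aElt_mul_kElt_mul_aElt (t t' θ : ℝ) :
    (aElt (-t) * kElt θ * aElt t') 0 0 ^ 2 + (aElt (-t) * kElt θ * aElt t') 0 1 ^ 2 +
      (aElt (-t) * kElt θ * aElt t') 1 0 ^ 2 + (aElt (-t) * kElt θ * aElt t') 1 1 ^ 2 =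
      2 * (Real.sin (θ / 2) ^ 2 * Real.cosh (t + t') +
        Real.cos (θ / 2) ^ 2 * Real.cosh (t - t')) := by
  have hexp (x : ℝ) : Real.exp x = Real.exp (x / 2) ^ 2 := by
    rw [← Real.exp_nat_mul]
    congr 1
    push_cast
    ring
  rw [Real.cosh_eq, Real.cosh_eq, hexp (t + t'), hexp (-(t + t')), hexp (t - t'),
    hexp (-(t - t')), show (t + t') / 2 = t / 2 + t' / 2 by ring,
    show -(t + t') / 2 = -(t / 2) + -(t' / 2) by ring,
    show (t - t') / 2 = t / 2 + -(t' / 2) by ring,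
    show -(t - t') / 2 = -(t / 2) + t' / 2 by ring]
  have hmul : ((aElt (-t) * kElt θ * aElt t' : SL(2, ℝ)) : Matrix (Fin 2) (Fin 2) ℝ) =
      !![Real.exp (-t / 2), 0; 0, Real.exp (-(-t / 2))] *
        !![Real.cos (θ / 2), Real.sin (θ / 2); -Real.sin (θ / 2), Real.cos (θ / 2)] *
        !![Real.exp (t' / 2), 0; 0, Real.exp (-(t' / 2))] := rfl
  rw [hmul]
  simp [Real.exp_add, neg_div]
  ring

/-- For all `t, t', θ ∈ ℝ` the sum of the squares of the four entries of
`a_{−t}·k_θ·a_{t'}` equals `2·(sin²(θ/2)·cosh(t+t') + cos²(θ/2)·cosh(t−t'))`;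
equivalently `cosh(H(a_{−t} k_θ a_{t'})) = sin²(θ/2)·cosh(t+t') + cos²(θ/2)·cosh(t−t')`. -/
theorem stmt_9 (t t' θ : ℝ) :
    (((aElt (-t) * kElt θ * aElt t' : SL(2, ℝ)) : Matrix (Fin 2) (Fin 2) ℝ) 0 0) ^ 2 +
      (((aElt (-t) * kElt θ * aElt t' : SL(2, ℝ)) : Matrix (Fin 2) (Fin 2) ℝ) 0 1) ^ 2 +
      (((aElt (-t) * kElt θ * aElt t' : SL(2, ℝ)) : Matrix (Fin 2) (Fin 2) ℝ) 1 0) ^ 2 +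
      (((aElt (-t) * kElt θ * aElt t' : SL(2, ℝ)) : Matrix (Fin 2) (Fin 2) ℝ) 1 1) ^ 2 =
      2 * (Real.sin (θ / 2) ^ 2 * Real.cosh (t + t') +
        Real.cos (θ / 2) ^ 2 * Real.cosh (t - t')) ∧
    Real.cosh (Hdisp (aElt (-t) * kElt θ * aElt t')) =
      Real.sin (θ / 2) ^ 2 * Real.cosh (t + t') +
        Real.cos (θ / 2) ^ 2 * Real.cosh (t - t') := by
  have h := sum_sq_aElt_mul_kElt_mul_aElt t t' θ
  exact ⟨h, mul_left_cancel₀ two_ne_zero ((two_mul_cosh_Hdisp _).trans h)⟩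
end

section
/- There exists a constant C > 0 (depending only on the normalization of μ) such that: for every R ≥ 0 and every measurable function f : G → ℝ satisfying (i) |f(g)| ≤ 1 for all g ∈ G, (ii) f(g) = 0 whenever H(g) > R, and (iii) f(k·g·k') = f(g) for all k, k' ∈ K and g ∈ G, the convolution F(x) = (f ∗ f̌)(x) = ∫_G f(g)·f(x⁻¹g) dμ(g) satisfies F(x) = 0 whenever H(x) > 2R, and |F(x)| ≤ C·e^{R − H(x)/2} for all x ∈ G. -/
open Matrix MatrixGroups MeasureTheory

/-- `SL(2,ℝ)` carries the subspace topology from the space of `2 × 2` real matrices. -/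
instance : TopologicalSpace SL(2, ℝ) := instTopologicalSpaceSubtype

/-- Membership in `K = SO(2) ⊂ SL(2,ℝ)`: the underlying matrix is orthogonal. -/
def inSO2 (k : SL(2, ℝ)) : Prop :=
  (k : Matrix (Fin 2) (Fin 2) ℝ)ᵀ * (k : Matrix (Fin 2) (Fin 2) ℝ) = 1

open UpperHalfPlane in
/-- The preimage in `SL(2,ℝ)`, under the orbit map of `I`, of the closed hyperbolic ball around
`z` whose radius has hyperbolic cosine `T`. -/
def orbitBall (z : ℍ) (T : ℝ) : Set SL(2, ℝ) :=
  {g | Real.cosh (dist (g • I) z) ≤ T}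

open UpperHalfPlane in
theorem isCompact_orbitBall (z : ℍ) (T : ℝ) : IsCompact (orbitBall z T) := by
  have hK : IsCompact {w : ℍ | Real.cosh (dist w z) ≤ T} := by
    refine (isCompact_closedBall z T).of_isClosed_subset
      (isClosed_le (by fun_prop) continuous_const) fun w hw => ?_
    have h₁ := Real.self_le_sinh_iff.2 (dist_nonneg (x := w) (y := z))
    exact h₁.trans ((Real.sinh_lt_cosh _).le.trans hw)
  exact isProperMap_smul_I.isCompact_preimage hK

open UpperHalfPlane in
theorem measure_orbitBall_eq [MeasurableSpace SL(2, ℝ)] [BorelSpace SL(2, ℝ)]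
    (μ : Measure SL(2, ℝ)) [μ.IsHaarMeasure] (z w : ℍ) (T : ℝ) :
    μ (orbitBall z T) = μ (orbitBall w T) := by
  obtain ⟨h, rfl⟩ := MulAction.exists_smul_eq SL(2, ℝ) z w
  have : ContinuousMul SL(2, ℝ) :=
    (Matrix.SpecialLinearGroup.topologicalGroup (n := Fin 2) (R := ℝ)).toContinuousMul
  have : MeasurableConstSMul SL(2, ℝ) SL(2, ℝ) :=
    ⟨fun c => (continuous_const_mul c).measurable⟩
  rw [← measure_preimage_mul μ h (orbitBall (h • z) T)]
  congr 1
  ext g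
  simp [orbitBall, mul_smul, dist_smul]

open UpperHalfPlane in
/-- A hyperbolic ball around `I` is covered by balls of fixed radius centred at the points
`j * 4 ^ k + 4 ^ k * i` with `k = n - p`, `p ≤ 2 * n` and `|j| ≤ 2 ^ (p + 1)`. -/
theorem exists_cosh_dist_le_nine (n : ℕ) (w : ℍ)
    (hw : 2 * Real.cosh (dist w I) ≤ 4 ^ n) :
    ∃ p ∈ Finset.range (2 * n + 1), ∃ j ∈ Finset.Icc (-(2 ^ (p + 1) : ℤ)) (2 ^ (p + 1)),
      Real.cosh (dist w ⟨⟨j * (4 : ℝ) ^ ((n : ℤ) - p), (4 : ℝ) ^ ((n : ℤ) - p)⟩, by positivity⟩)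
        ≤ 9 := by
  have hy := w.im_pos
  rw [cosh_dist', ← mul_div_assoc, div_le_iff₀ (by simp [hy])] at hw
  simp only [I_re, I_im, sub_zero, one_pow, mul_one] at hw
  have hy1 : 1 ≤ 4 ^ n * w.im := by nlinarith [sq_nonneg w.re, sq_nonneg w.im]
  have hy2 : w.im ≤ 4 ^ n := by
    by_contra! h
    nlinarith [sq_nonneg w.re]
  have hx : w.re ^ 2 ≤ 4 ^ n * w.im := by nlinarith [sq_nonneg w.re, sq_nonneg w.im]
  obtain ⟨k, hk1, hk2⟩ := exists_mem_Ico_zpow hy (by norm_num : (1 : ℝ) < 4)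
  have hkn : k ≤ n := by
    have : (4 : ℝ) ^ k ≤ 4 ^ (n : ℤ) := by simpa using hk1.trans hy2
    exact (zpow_le_zpow_iff_right₀ (by norm_num)).1 this
  have hkn' : -(n : ℤ) ≤ k := by
    have : (4 : ℝ) ^ (-(n : ℤ)) < 4 ^ (k + 1) := by
      refine lt_of_le_of_lt ?_ hk2
      rw [_root_.zpow_neg, zpow_natCast]
      exact (inv_le_iff_one_le_mul₀' (by positivity)).2 hy1
    have := (zpow_lt_zpow_iff_right₀ (by norm_num)).1 this
    omega
  obtain ⟨p, hp⟩ := Int.eq_ofNat_of_zero_le (sub_nonneg.2 hkn)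
  have hk : k = n - p := by omega
  have hs : (0 : ℝ) < 4 ^ k := by positivity
  have h4n : (4 : ℝ) ^ n = 4 ^ k * (2 ^ p) ^ 2 := by
    rw [← pow_mul, mul_comm p 2, pow_mul, ← zpow_natCast, ← zpow_natCast,
      show (2 : ℝ) ^ 2 = 4 by norm_num, ← zpow_add₀ (by norm_num)]
    congr 1
    omega
  rw [zpow_add_one₀ (by norm_num)] at hk2
  have hxs : |w.re| ≤ 4 ^ k * 2 ^ (p + 1) := by
    refine abs_le_of_sq_le_sq (hx.trans ?_) (by positivity)
    calc (4 : ℝ) ^ n * w.im ≤ 4 ^ n * (4 ^ k * 4) := by gcongr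
      _ = (4 ^ k * 2 ^ (p + 1)) ^ 2 := by rw [h4n]; ring
  rw [abs_le] at hxs
  have hj1 : (⌊w.re / 4 ^ k⌋ : ℝ) * 4 ^ k ≤ w.re := by
    rw [← le_div_iff₀ hs]; exact Int.floor_le _
  have hj2 : w.re < (⌊w.re / 4 ^ k⌋ + 1 : ℝ) * 4 ^ k := by
    rw [← div_lt_iff₀ hs]; exact Int.lt_floor_add_one _
  refine ⟨p, by rw [Finset.mem_range]; omega, ⌊w.re / 4 ^ k⌋, ?_, ?_⟩
  · rw [Finset.mem_Icc]
    constructor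
    · rw [Int.le_floor, le_div_iff₀ hs]
      push_cast
      linarith [hxs.1]
    · have : w.re / 4 ^ k ≤ 2 ^ (p + 1) := by
        rw [div_le_iff₀ hs]; linarith [hxs.2]
      exact_mod_cast (Int.floor_le _).trans this
  · rw [cosh_dist', ← hk]
    simp only [mk_re, mk_im]
    rw [div_le_iff₀ (by positivity)]
    have h3 : (w.re - ⌊w.re / 4 ^ k⌋ * 4 ^ k) ^ 2 ≤ (4 ^ k) ^ 2 :=
      pow_le_pow_left₀ (by linarith) (by linarith) 2
    nlinarith

open UpperHalfPlane in
theorem measure_orbitBall_le [MeasurableSpace SL(2, ℝ)] [BorelSpace SL(2, ℝ)]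
    (μ : Measure SL(2, ℝ)) [μ.IsHaarMeasure] (z : ℍ) {T : ℝ} (hT : 1 ≤ T) :
    μ (orbitBall z T) ≤ ENNReal.ofReal (80 * T) * μ (orbitBall I 9) := by
  obtain ⟨m, hm1, hm2⟩ := exists_nat_pow_near (x := 2 * T) (by linarith) (by norm_num : (1 : ℝ) < 4)
  rw [measure_orbitBall_eq μ z I T]
  set n := m + 1
  let c : ℕ → ℤ → ℍ := fun p j =>
    ⟨⟨j * (4 : ℝ) ^ ((n : ℤ) - p), (4 : ℝ) ^ ((n : ℤ) - p)⟩, by positivity⟩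
  have hsub : orbitBall I T ⊆ ⋃ p ∈ Finset.range (2 * n + 1),
      ⋃ j ∈ Finset.Icc (-(2 ^ (p + 1) : ℤ)) (2 ^ (p + 1)), orbitBall (c p j) 9 := by
    intro g hg
    have hg : Real.cosh (dist (g • I) I) ≤ T := hg
    obtain ⟨p, hp, j, hj, h⟩ := exists_cosh_dist_le_nine n (g • I) (by linarith)
    simp only [Set.mem_iUnion]
    exact ⟨p, hp, j, hj, h⟩
  have hcard (p : ℕ) :
      ((Finset.Icc (-(2 ^ (p + 1) : ℤ)) (2 ^ (p + 1))).card : ℝ) ≤ 5 * 2 ^ p := by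
    have h1 : (1 : ℤ) ≤ 2 ^ p := one_le_pow₀ (by norm_num)
    have h2 : ((Finset.Icc (-(2 ^ (p + 1) : ℤ)) (2 ^ (p + 1))).card : ℤ) ≤ 5 * 2 ^ p := by
      rw [Int.card_Icc, pow_succ]
      omega
    exact_mod_cast h2
  have hcount : ((∑ p ∈ Finset.range (2 * n + 1),
      (Finset.Icc (-(2 ^ (p + 1) : ℤ)) (2 ^ (p + 1))).card : ℕ) : ℝ) ≤ 80 * T := by
    push_cast
    refine (Finset.sum_le_sum fun p _ => hcard p).trans ?_
    rw [← Finset.mul_sum, geom_sum_eq (by norm_num), pow_succ, pow_mul,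
      show (2 : ℝ) ^ 2 = 4 by norm_num, show n = m + 1 from rfl, pow_succ]
    linarith
  calc μ (orbitBall I T)
      ≤ ∑ p ∈ Finset.range (2 * n + 1),
          ∑ j ∈ Finset.Icc (-(2 ^ (p + 1) : ℤ)) (2 ^ (p + 1)), μ (orbitBall (c p j) 9) :=
        (measure_mono hsub).trans <| (measure_biUnion_finset_le _ _).trans <|
          Finset.sum_le_sum fun p _ => measure_biUnion_finset_le _ _
    _ = ((∑ p ∈ Finset.range (2 * n + 1),
          (Finset.Icc (-(2 ^ (p + 1) : ℤ)) (2 ^ (p + 1))).card : ℕ) : ENNReal)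
          * μ (orbitBall I 9) := by
        simp_rw [fun p j => measure_orbitBall_eq μ (c p j) I 9, Finset.sum_const, nsmul_eq_mul,
          ← Finset.sum_mul, Nat.cast_sum]
    _ ≤ ENNReal.ofReal (80 * T) * μ (orbitBall I 9) := by
        gcongr
        rw [← ENNReal.ofReal_natCast]
        exact ENNReal.ofReal_le_ofReal hcount

open UpperHalfPlane in
/-- The hyperbolic median formula, with `m` the midpoint of `I` and `z`. -/
theorem exists_midpoint_cosh_dist (z : ℍ) :
    ∃ m : ℍ, ∀ w : ℍ, Real.cosh (dist w I) + Real.cosh (dist w z) =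
      2 * Real.cosh (dist z I / 2) * Real.cosh (dist w m) := by
  have hv := z.im_pos
  have hq : 0 < z.im * ((1 + z.im) ^ 2 + z.re ^ 2) := by positivity
  set b : ℝ := √(z.im * ((1 + z.im) ^ 2 + z.re ^ 2)) / (1 + z.im) with hb
  have hb0 : 0 < b := div_pos (Real.sqrt_pos.2 hq) (by linarith)
  have hb2 : b ^ 2 * (1 + z.im) ^ 2 = z.im * ((1 + z.im) ^ 2 + z.re ^ 2) := by
    rw [hb, div_pow, Real.sq_sqrt hq.le]
    field_simp
  have hc : 2 * Real.cosh (dist z I / 2) = (1 + z.im) * b / z.im := by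
    rw [← sq_eq_sq₀ (by positivity) (by positivity), mul_pow]
    have h2 := Real.cosh_two_mul (dist z I / 2)
    rw [mul_div_cancel₀ _ two_ne_zero, cosh_dist', Real.sinh_sq] at h2
    simp only [I_re, I_im] at h2
    have h3 : Real.cosh (dist z I / 2) ^ 2 = ((1 + z.im) ^ 2 + z.re ^ 2) / (4 * z.im) := by
      have : 2 * Real.cosh (dist z I / 2) ^ 2 =
        ((z.re - 0) ^ 2 + z.im ^ 2 + 1 ^ 2) / (2 * z.im * 1) + 1 := by linarith
      field_simp at this ⊢
      linarith
    rw [h3, div_pow, mul_pow, mul_comm ((1 + z.im) ^ 2), hb2]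
    field_simp
    ring
  refine ⟨⟨⟨z.re / (1 + z.im), b⟩, hb0⟩, fun w => ?_⟩
  have hw := w.im_pos
  rw [hc, cosh_dist', cosh_dist', cosh_dist']
  simp only [I_re, I_im, mk_re, mk_im]
  have h1 : (1 + z.im) ≠ 0 := by positivity
  field_simp
  linear_combination (-1 : ℝ) * hb2

/-- Let `μ` be a Haar measure on `G = SL(2,ℝ)`.  There is a constant
`C > 0` (depending only on the normalization of `μ`) such that for every `R ≥ 0` and
every measurable `f : G → ℝ` with `|f| ≤ 1`, vanishing where `H(g) > R`, and
bi-`K`-invariant, the convolution `F(x) = (f ∗ f̌)(x) = ∫ f(g)·f(x⁻¹g) dμ(g)` vanishes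
whenever `H(x) > 2R` and satisfies `|F(x)| ≤ C·e^{R − H(x)/2}` for all `x`. -/
theorem stmt_10 [MeasurableSpace SL(2, ℝ)] [BorelSpace SL(2, ℝ)]
    (μ : Measure SL(2, ℝ)) [μ.IsHaarMeasure] :
    ∃ C > (0 : ℝ), ∀ R : ℝ, 0 ≤ R →
      ∀ f : SL(2, ℝ) → ℝ, Measurable f →
        (∀ g, |f g| ≤ 1) →
        (∀ g, R < Hdisp g → f g = 0) →
        (∀ k k' g, inSO2 k → inSO2 k' → f (k * g * k') = f g) →
        (∀ x, 2 * R < Hdisp x → (∫ g, f g * f (x⁻¹ * g) ∂μ) = 0) ∧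
        (∀ x, |∫ g, f g * f (x⁻¹ * g) ∂μ| ≤ C * Real.exp (R - Hdisp x / 2)) := by
  refine ⟨160 * μ.real (orbitBall UpperHalfPlane.I 9) + 1, by positivity,
    fun R hR f _ hf1 hf0 _ => ?_⟩
  have hsupp (x g : SL(2, ℝ)) (h : f g * f (x⁻¹ * g) ≠ 0) :
      dist (g • UpperHalfPlane.I) UpperHalfPlane.I ≤ R ∧
      dist (g • UpperHalfPlane.I) (x • UpperHalfPlane.I) ≤ R := by
    obtain ⟨h1, h2⟩ := mul_ne_zero_iff.1 h
    refine ⟨not_lt.1 fun h => h1 (hf0 g h), not_lt.1 fun h => h2 (hf0 _ ?_)⟩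
    rwa [Hdisp, mul_smul, ← dist_smul x, smul_inv_smul]
  have hvanish (x : SL(2, ℝ)) (hx : 2 * R < Hdisp x) : (∫ g, f g * f (x⁻¹ * g) ∂μ) = 0 := by
    refine integral_eq_zero_of_ae (.of_forall fun g => ?_)
    by_contra h
    obtain ⟨h1, h2⟩ := hsupp x g h
    have := dist_triangle_left (x • UpperHalfPlane.I) UpperHalfPlane.I (g • UpperHalfPlane.I)
    rw [Hdisp] at hx
    linarith
  refine ⟨hvanish, fun x => ?_⟩
  by_cases hx : 2 * R < Hdisp x
  · rw [hvanish x hx, abs_zero]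
    positivity
  obtain ⟨m, hm⟩ := exists_midpoint_cosh_dist (x • UpperHalfPlane.I)
  set T := 2 * Real.exp (R - Hdisp x / 2) with hTdef
  have hT : 1 ≤ T := by
    have := Real.one_le_exp (x := R - Hdisp x / 2) (by linarith)
    linarith
  have hzero : ∀ g ∉ orbitBall m T, f g * f (x⁻¹ * g) = 0 := by
    intro g hg
    by_contra h
    obtain ⟨h1, h2⟩ := hsupp x g h
    refine hg ?_
    have hcR (t : ℝ) (ht0 : 0 ≤ t) (ht : t ≤ R) : Real.cosh t ≤ Real.exp R := by
      rw [Real.cosh_eq]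
      have := Real.exp_le_exp.2 ht
      have := Real.exp_le_exp.2 (show -t ≤ R by linarith)
      linarith
    have hsum := hm (g • UpperHalfPlane.I)
    have h3 := hcR _ dist_nonneg h1
    have h4 := hcR _ dist_nonneg h2
    have h5 : Real.exp (Hdisp x / 2) ≤
        2 * Real.cosh (dist (x • UpperHalfPlane.I) UpperHalfPlane.I / 2) := by
      rw [Real.cosh_eq, Hdisp]
      have := Real.exp_pos (-(dist (x • UpperHalfPlane.I) UpperHalfPlane.I / 2))
      linarith
    have h6 := mul_le_mul_of_nonneg_right h5
      (Real.cosh_pos (dist (g • UpperHalfPlane.I) m)).le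
    change Real.cosh (dist (g • UpperHalfPlane.I) m) ≤ T
    rw [hTdef, Real.exp_sub, ← mul_div_assoc, le_div_iff₀ (Real.exp_pos _)]
    linarith
  have hfin (z : UpperHalfPlane) (t : ℝ) : μ (orbitBall z t) < ⊤ :=
    (isCompact_orbitBall z t).measure_lt_top
  have hvol : μ.real (orbitBall m T) ≤ 80 * T * μ.real (orbitBall UpperHalfPlane.I 9) := by
    have h := ENNReal.toReal_mono
      (ENNReal.mul_ne_top ENNReal.ofReal_ne_top (hfin UpperHalfPlane.I 9).ne)
      (measure_orbitBall_le μ m hT)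
    rwa [ENNReal.toReal_mul, ENNReal.toReal_ofReal (by positivity)] at h
  rw [← setIntegral_eq_integral_of_forall_compl_eq_zero hzero, ← Real.norm_eq_abs]
  calc ‖∫ g in orbitBall m T, f g * f (x⁻¹ * g) ∂μ‖
      ≤ 1 * μ.real (orbitBall m T) :=
        norm_setIntegral_le_of_norm_le_const (hfin m T) fun g _ => by
          rw [Real.norm_eq_abs, abs_mul]
          exact mul_le_one₀ (hf1 _) (abs_nonneg _) (hf1 _)
    _ ≤ 80 * T * μ.real (orbitBall UpperHalfPlane.I 9) := by rwa [one_mul]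
    _ ≤ (160 * μ.real (orbitBall UpperHalfPlane.I 9) + 1) * Real.exp (R - Hdisp x / 2) := by
        rw [hTdef]
        linarith [Real.exp_pos (R - Hdisp x / 2)]
end
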